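/- (Free valuation congruence separates basic forms) For all basic forms P and Q, if P =_fr Q (where fr is the class of all valuation algebras), then P ≡ Q, i.e., P and Q are syntactically equal. -/

import Mathlib

/-- Propositional statements over atoms `A`: constants `T`, `F`, an atom `a`
for each `a ∈ A`, and the ternary conditional composition
`cond x y z = x ◁ y ▷ z` (with `y` the central condition). -/
inductive PS (A : Type) : Type where
  | tt : PS A
  | ff : PS A
  | atom : A → PS A
  | cond : PS A → PS A → PS A → PS A

/-- A valuation algebra (VA) over `A`. -/
structure VA (A : Type) where
  Val : Type
  Tv : Val
  Fv : Val
  yd : A → Val → Bool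
  dv : A → Val → Val
  yd_T : ∀ a, yd a Tv = true
  yd_F : ∀ a, yd a Fv = false
  dv_T : ∀ a, dv a Tv = Tv
  dv_F : ∀ a, dv a Fv = Fv

variable {A : Type}

mutual
  /-- Evaluation `P/H` of a propositional statement over a valuation `H`. -/
  def PS.eval (V : VA A) : PS A → V.Val → Bool
    | .tt, _ => true
    | .ff, _ => false
    | .atom a, H => V.yd a H
    | .cond p q r, H =>
        if PS.eval V q H then PS.eval V p (PS.deriv V q H)
        else PS.eval V r (PS.deriv V q H)
  /-- The generalized derivative `∂_P(H)`. -/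
  def PS.deriv (V : VA A) : PS A → V.Val → V.Val
    | .tt, H => H
    | .ff, H => H
    | .atom a, H => V.dv a H
    | .cond p q r, H =>
        if PS.eval V q H then PS.deriv V p (PS.deriv V q H)
        else PS.deriv V r (PS.deriv V q H)
end

/-- `K`-equivalence: equal evaluation results in all members of the class `K`. -/
def KEquiv (K : VA A → Prop) (P Q : PS A) : Prop :=
  ∀ V : VA A, K V → ∀ H : V.Val, PS.eval V P H = PS.eval V Q H

/-- A congruence with respect to conditional composition. -/
def IsCondCongruence (R : PS A → PS A → Prop) : Prop :=
  Equivalence R ∧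
    ∀ ⦃x x' y y' z z' : PS A⦄, R x x' → R y y' → R z z' →
      R (PS.cond x y z) (PS.cond x' y' z')

/-- `K`-congruence: the largest congruence contained in `K`-equivalence. -/
def KCong (K : VA A → Prop) (P Q : PS A) : Prop :=
  ∃ R : PS A → PS A → Prop,
    IsCondCongruence R ∧ (∀ x y, R x y → KEquiv K x y) ∧ R P Q

/-- Derivability (of closed equations) in equational logic from the axioms `CP`
together with an additional set `Ax` of equational axioms. -/
inductive Deriv (Ax : PS A → PS A → Prop) : PS A → PS A → Prop where
  | ax {p q} : Ax p q → Deriv Ax p q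
  | cp1 (x y) : Deriv Ax (.cond x .tt y) x
  | cp2 (x y) : Deriv Ax (.cond x .ff y) y
  | cp3 (x) : Deriv Ax (.cond .tt x .ff) x
  | cp4 (x y z u v) :
      Deriv Ax (.cond x (.cond y z u) v)
               (.cond (.cond x y v) z (.cond x u v))
  | refl (x) : Deriv Ax x x
  | symm {p q} : Deriv Ax p q → Deriv Ax q p
  | trans {p q r} : Deriv Ax p q → Deriv Ax q r → Deriv Ax p r
  | congr {x x' y y' z z'} : Deriv Ax x x' → Deriv Ax y y' → Deriv Ax z z' →
      Deriv Ax (.cond x y z) (.cond x' y' z')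

/-- No additional axioms: plain `CP`. -/
def NoAx : PS A → PS A → Prop := fun _ _ => False

/-- The class `fr` of free valuation algebras: all VAs. -/
def frK : VA A → Prop := fun _ => True

/-- The class `rp` of repetition-proof VAs. -/
def rpK (V : VA A) : Prop :=
  ∀ (a : A) (x : V.Val), V.yd a x = V.yd a (V.dv a x)

/-- The class `cr` of contractive VAs. -/
def crK (V : VA A) : Prop :=
  rpK V ∧ ∀ (a : A) (x : V.Val), V.dv a (V.dv a x) = V.dv a x

/-- The class `wm` of weakly memorizing VAs. -/
def wmK (V : VA A) : Prop :=
  crK V ∧ ∀ (a b : A) (x : V.Val),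
    V.yd b (V.dv a x) = V.yd a x →
      V.dv a (V.dv b (V.dv a x)) = V.dv b (V.dv a x) ∧
      V.yd a (V.dv b (V.dv a x)) = V.yd a x

/-- The class `mem` of memorizing VAs. -/
def memK (V : VA A) : Prop :=
  crK V ∧ ∀ (a b : A) (x : V.Val),
    V.dv a (V.dv b (V.dv a x)) = V.dv b (V.dv a x) ∧
    V.yd a (V.dv b (V.dv a x)) = V.yd a x

/-- The class `st` of static VAs. -/
def stK (V : VA A) : Prop :=
  ∀ (a b : A) (x : V.Val), V.yd a (V.dv b x) = V.yd a x

/-- Basic forms: `T`, `F`, or `P1 ◁ a ▷ P2` with `a ∈ A` and `P1`, `P2`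
basic forms. -/
inductive BasicForm {A : Type} : PS A → Prop where
  | tt : BasicForm .tt
  | ff : BasicForm .ff
  | cond {p q : PS A} (a : A) :
      BasicForm p → BasicForm q → BasicForm (.cond p (.atom a) q)

/-- The valuation algebra of all answer functions: `H l c` is the answer to atom `c` after the
atoms in `l` have been queried. -/
def answerVA (A : Type) : VA A where
  Val := List A → A → Bool
  Tv := fun _ _ => true
  Fv := fun _ _ => false
  yd a H := H [] a
  dv a H := fun l c => H (a :: l) c
  yd_T _ := rfl
  yd_F _ := rfl
  dv_T _ := rfl
  dv_F _ := rfl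

/-- The statement that queries the atoms in a list, ignores the answers, and returns the
answer to a final atom. -/
def PS.query : List A → A → PS A
  | [], c => .atom c
  | a :: l, c => .cond (PS.query l c) (.atom a) (PS.query l c)

theorem PS.eval_query (l : List A) (c : A) (H : (answerVA A).Val) :
    PS.eval (answerVA A) (PS.query l c) H = H l c := by
  induction l generalizing H with
  | nil => simp [PS.query, PS.eval, answerVA]
  | cons a l ih =>
    simp only [PS.query, PS.eval, PS.deriv, ih, ite_self]
    rfl

theorem PS.deriv_Tv (V : VA A) (P : PS A) : PS.deriv V P V.Tv = V.Tv := by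
  induction P with
  | tt => simp [PS.deriv]
  | ff => simp [PS.deriv]
  | atom a => simp [PS.deriv, V.dv_T]
  | cond p q r hp hq hr => simp [PS.deriv, hp, hq, hr]

theorem PS.deriv_Fv (V : VA A) (P : PS A) : PS.deriv V P V.Fv = V.Fv := by
  induction P with
  | tt => simp [PS.deriv]
  | ff => simp [PS.deriv]
  | atom a => simp [PS.deriv, V.dv_F]
  | cond p q r hp hq hr => simp [PS.deriv, hp, hq, hr]

theorem PS.deriv_cond_atom_of_dv_eq_Tv {V : VA A} {a : A} {H : V.Val} (h : V.dv a H = V.Tv)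
    (p q : PS A) : PS.deriv V (.cond p (.atom a) q) H = V.Tv := by
  simp [PS.deriv, h, PS.deriv_Tv]

theorem PS.deriv_cond_atom_of_dv_eq_Fv {V : VA A} {a : A} {H : V.Val} (h : V.dv a H = V.Fv)
    (p q : PS A) : PS.deriv V (.cond p (.atom a) q) H = V.Fv := by
  simp [PS.deriv, h, PS.deriv_Fv]

/-- Querying an atom changes some valuation, whatever is done afterwards. -/
theorem PS.exists_deriv_cond_atom_ne (a : A) (p q : PS A) :
    ∃ H, PS.deriv (answerVA A) (.cond p (.atom a) q) H ≠ H := by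
  let H : (answerVA A).Val := fun l _ => l.isEmpty
  refine ⟨H, fun h => ?_⟩
  rw [PS.deriv_cond_atom_of_dv_eq_Fv (by rfl)] at h
  simpa [answerVA, H] using congrFun (congrFun h []) a

/-- Basic forms with different root atoms have different derivatives. -/
theorem PS.exists_deriv_cond_atom_ne_of_ne {a b : A} (hab : a ≠ b) (p q r s : PS A) :
    ∃ H, PS.deriv (answerVA A) (.cond p (.atom a) q) H ≠
      PS.deriv (answerVA A) (.cond r (.atom b) s) H := by
  classical
  let H : (answerVA A).Val := fun l _ => decide (l.head? = some a)
  refine ⟨H, fun h => ?_⟩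
  rw [PS.deriv_cond_atom_of_dv_eq_Tv (by funext l c; simp [answerVA, H]),
    PS.deriv_cond_atom_of_dv_eq_Fv (by funext l c; simp [answerVA, H, hab.symm])] at h
  simpa [answerVA] using congrFun (congrFun h []) a

/-- A valuation with prescribed answers now and a prescribed valuation afterwards. -/
theorem answerVA_exists_yd_dv (a : A) (b : Bool) (H : (answerVA A).Val) :
    ∃ G, (answerVA A).yd a G = b ∧ (answerVA A).dv a G = H :=
  ⟨fun | [], _ => b | _ :: l, c => H l c, rfl, rfl⟩

/-- Basic forms are determined by their evaluations and derivatives over answer functions. -/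
theorem BasicForm.eq_of_eval_eq_of_deriv_eq {P Q : PS A} (hP : BasicForm P) (hQ : BasicForm Q)
    (he : ∀ H, PS.eval (answerVA A) P H = PS.eval (answerVA A) Q H)
    (hd : ∀ H, PS.deriv (answerVA A) P H = PS.deriv (answerVA A) Q H) : P = Q := by
  induction hP generalizing Q with
  | tt =>
    cases hQ with
    | tt => rfl
    | ff => simpa [PS.eval] using he (answerVA A).Tv
    | cond b =>
      obtain ⟨H, hH⟩ := PS.exists_deriv_cond_atom_ne b _ _
      exact absurd ((hd H).symm.trans (by simp [PS.deriv])) hH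
  | ff =>
    cases hQ with
    | tt => simpa [PS.eval] using he (answerVA A).Tv
    | ff => rfl
    | cond b =>
      obtain ⟨H, hH⟩ := PS.exists_deriv_cond_atom_ne b _ _
      exact absurd ((hd H).symm.trans (by simp [PS.deriv])) hH
  | cond a _ _ ihp ihq =>
    cases hQ with
    | tt =>
      obtain ⟨H, hH⟩ := PS.exists_deriv_cond_atom_ne a _ _
      exact absurd ((hd H).trans (by simp [PS.deriv])) hH
    | ff =>
      obtain ⟨H, hH⟩ := PS.exists_deriv_cond_atom_ne a _ _
      exact absurd ((hd H).trans (by simp [PS.deriv])) hH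
    | cond b hr hs =>
      obtain rfl : a = b := by
        by_contra hab
        obtain ⟨H, hH⟩ := PS.exists_deriv_cond_atom_ne_of_ne hab _ _ _ _
        exact hH (hd H)
      congr 1
      · refine ihp hr (fun H => ?_) (fun H => ?_) <;>
          obtain ⟨G, hy, rfl⟩ := answerVA_exists_yd_dv a true H
        · simpa [PS.eval, PS.deriv, hy] using he G
        · simpa [PS.eval, PS.deriv, hy] using hd G
      · refine ihq hs (fun H => ?_) (fun H => ?_) <;>
          obtain ⟨G, hy, rfl⟩ := answerVA_exists_yd_dv a false H
        · simpa [PS.eval, PS.deriv, hy] using he G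
        · simpa [PS.eval, PS.deriv, hy] using hd G

/-- **Free valuation congruence separates basic forms**: if basic forms `P`
and `Q` are free-valuation congruent, then they are syntactically equal. -/
theorem fr_congruence_separates_basic_forms {A : Type} [Countable A]
    [Nontrivial A] (P Q : PS A) (hP : BasicForm P) (hQ : BasicForm Q)
    (h : KCong frK P Q) : P = Q := by
  obtain ⟨R, ⟨hR, hcond⟩, hle, hPQ⟩ := h
  refine hP.eq_of_eval_eq_of_deriv_eq hQ (fun H => hle _ _ hPQ _ trivial H) (fun H => ?_)
  funext l c
  have h := hle _ _ (hcond (hR.refl (PS.query l c)) hPQ (hR.refl (PS.query l c)))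
    (answerVA A) trivial H
  simpa [PS.eval, PS.eval_query] using h
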